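/- Let N ≥ 2 be an integer and y : ℤ/Nℤ → ℂ a function with y(−a) = y(a) for all a. Then det(Y_N) = (−1)^{N⁺(N⁺+1)/2} · 2^{N⁺+1−N⁻} · N^{−(N⁺+1)/2} · ∏_{d | N} ∏_{χ even} ( d · Σ_{t ∈ (ℤ/N_dℤ)^×} ŷ_d(t)·χ(t) ), where for each positive divisor d of N the inner product runs over all even Dirichlet characters χ modulo N_d = N/d (those with χ(−1) = 1). -/

import Mathlib

/-- The matrix `Y_N` attached to an even function `y : ℤ/Nℤ → ℂ`:
its `(i,j)` entry is `y(ij mod N)`, `0 ≤ i,j ≤ N⁺ = ⌊N/2⌋`. -/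
def YMat (N : ℕ) (y : ZMod N → ℂ) : Matrix (Fin (N / 2 + 1)) (Fin (N / 2 + 1)) ℂ :=
  Matrix.of fun i j => y (((i : ℕ) : ZMod N) * ((j : ℕ) : ZMod N))

/-- `ŷ_d(t) = (1/2)·Σ_{r=1}^{N_d} y(dr mod N)·cos(2πtr/N_d)`, where `N_d = N/d`. -/
noncomputable def yhat (N d : ℕ) (y : ZMod N → ℂ) (t : ZMod (N / d)) : ℂ :=
  (1 / 2 : ℂ) * ∑ r ∈ Finset.Icc 1 (N / d),
    y (((d * r : ℕ) : ZMod N)) *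
      (Real.cos (2 * Real.pi * (ZMod.val t) * r / ((N / d : ℕ) : ℝ)) : ℝ)

open scoped Classical in
/-- `∏_{χ even} (c · Σ_{t ∈ (ℤ/nℤ)ˣ} g(t)·χ(t))`, the product running over all even
Dirichlet characters `χ` modulo `n` (those with `χ(−1) = 1`).
(The value for `n = 0` is irrelevant and set to `1`.) -/
noncomputable def charProdEven (c : ℂ) : (n : ℕ) → (ZMod n → ℂ) → ℂ
  | 0, _ => 1
  | (n + 1), g =>
      ∏ χ : DirichletCharacter ℂ (n + 1),
        if χ (-1) = 1 then
          (c * ∑ t : (ZMod (n + 1))ˣ, g (t : ZMod (n + 1)) * χ (t : ZMod (n + 1)))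
        else 1

open Finset

/-- Dedekind's determinant formula for a finite abelian group. -/
lemma det_of_inv_mul_eq_prod_monoidHom {Q : Type*} [CommGroup Q] [Fintype Q] [DecidableEq Q]
    [Fintype (Q →* ℂˣ)] (f : Q → ℂ) :
    (Matrix.of fun a b : Q => f (a⁻¹ * b)).det = ∏ ψ : Q →* ℂˣ, ∑ t, f t * (ψ t : ℂ) := by
  have hroots : HasEnoughRootsOfUnity ℂ (Monoid.exponent Q) :=
    haveI : NeZero (Monoid.exponent Q) := ⟨Monoid.exponent_ne_zero_of_finite⟩
    inferInstance
  obtain ⟨e⟩ := CommGroup.monoidHom_mulEquiv_of_hasEnoughRootsOfUnity Q ℂ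
  set X : Matrix Q Q ℂ := Matrix.of fun a b => ((e.symm b a : ℂˣ) : ℂ) with hX
  have hXunit : IsUnit X := by
    rw [← Matrix.linearIndependent_cols_iff_isUnit]
    have hinj : Function.Injective fun b : Q => (Units.coeHom ℂ).comp (e.symm b) := by
      intro b c h
      apply e.symm.injective
      ext a
      exact DFunLike.congr_fun h a
    have hcol : X.col = fun b : Q => ⇑((Units.coeHom ℂ).comp (e.symm b)) := rfl
    rw [hcol]
    exact (linearIndependent_monoidHom Q ℂ).comp
      (fun b : Q => (Units.coeHom ℂ).comp (e.symm b)) hinj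
  have key : (Matrix.of fun a b : Q => f (a⁻¹ * b)) * X =
      X * Matrix.diagonal fun b => ∑ t, f t * ((e.symm b t : ℂˣ) : ℂ) := by
    ext a b
    rw [Matrix.mul_diagonal, Matrix.mul_apply, Finset.mul_sum,
      ← Equiv.sum_comp (Equiv.mulLeft a)]
    refine Finset.sum_congr rfl fun t _ => ?_
    simp only [hX, Matrix.of_apply, Equiv.coe_mulLeft, inv_mul_cancel_left, map_mul,
      Units.val_mul]
    ring
  have hdet := congrArg Matrix.det key
  rw [Matrix.det_mul, Matrix.det_mul, Matrix.det_diagonal, mul_comm] at hdet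
  have h0 : X.det ≠ 0 := ((Matrix.isUnit_iff_isUnit_det X).1 hXunit).ne_zero
  rw [mul_left_cancel₀ h0 hdet]
  exact e.symm.toEquiv.prod_comp fun ψ : Q →* ℂˣ => ∑ t, f t * (ψ t : ℂ)

/-- Dedekind's determinant formula for a quotient of a finite abelian group, expressed on the group
itself and on any system of representatives of the quotient. -/
lemma det_of_inv_mul_eq_prod_of_bijective {G S : Type*} [CommGroup G] [Fintype G]
    [Fintype S] [DecidableEq S] [Fintype (G →* ℂˣ)]
    (H : Subgroup G) (u : S → G) (hu : Function.Bijective fun s => (u s : G ⧸ H)) (F : G → ℂ)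
    (hF : ∀ g, ∀ h ∈ H, F (g * h) = F g) [DecidablePred fun ψ : G →* ℂˣ => H ≤ ψ.ker] :
    (Matrix.of fun a b : S => Nat.card H * F ((u a)⁻¹ * u b)).det =
      ∏ ψ : G →* ℂˣ with H ≤ ψ.ker, ∑ t, F t * (ψ t : ℂ) := by
  classical
  let f : G ⧸ H → ℂ := Quotient.lift F fun a b hab => by
    rw [← hF a _ (QuotientGroup.leftRel_apply.1 hab), mul_inv_cancel_left]
  have hf (g : G) : f (g : G ⧸ H) = F g := rfl
  have hsum (φ : G ⧸ H → ℂ) : ∑ t : G, φ (t : G ⧸ H) = Nat.card H * ∑ q, φ q := by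
    rw [← Finset.sum_fiberwise univ (fun t : G => (t : G ⧸ H)), Finset.mul_sum]
    refine Finset.sum_congr rfl fun q _ => ?_
    rw [Finset.sum_congr rfl (g := fun _ => φ q)
      (fun t ht => by rw [(Finset.mem_filter.1 ht).2]), Finset.sum_const, nsmul_eq_mul]
    congr 2
    have := QuotientGroup.card_preimage_mk H {q}
    rw [Nat.card_eq_fintype_card (α := ({q} : Set (G ⧸ H))), Fintype.card_unique, mul_one] at this
    rw [← this, ← Nat.card_eq_finsetCard]
    exact Nat.card_congr (Equiv.subtypeEquivRight fun t => by simp)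
  have : Fintype (G ⧸ H →* ℂˣ) := Fintype.ofFinite _
  have h1 : (Matrix.of fun a b : S => Nat.card H * F ((u a)⁻¹ * u b)) =
      (Matrix.of fun a b : G ⧸ H => (fun q => Nat.card H * f q) (a⁻¹ * b)).submatrix
        (Equiv.ofBijective _ hu) (Equiv.ofBijective _ hu) := by
    ext a b
    rfl
  rw [h1, Matrix.det_submatrix_equiv_self,
    det_of_inv_mul_eq_prod_monoidHom fun q => Nat.card H * f q]
  refine Finset.prod_bij (fun ψ _ => ψ.comp (QuotientGroup.mk' H)) ?_ ?_ ?_ ?_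
  · intro ψ _
    simp only [Finset.mem_filter, Finset.mem_univ, true_and]
    intro h hh
    simp [MonoidHom.mem_ker, (QuotientGroup.eq_one_iff h).2 hh]
  · intro ψ _ ψ' _ h
    exact QuotientGroup.monoidHom_ext H h
  · intro ψ hψ
    refine ⟨QuotientGroup.lift H ψ fun x hx => (Finset.mem_filter.1 hψ).2 hx, Finset.mem_univ _, ?_⟩
    ext x
    simp
  · intro ψ _
    have := hsum fun q => f q * (ψ q : ℂ)
    simp only [hf] at this
    simp only [MonoidHom.comp_apply, QuotientGroup.mk'_apply, this, Finset.mul_sum, mul_assoc]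

open Polynomial in
lemma det_eval_chebyshevT {n : ℕ} (v : Fin n → ℝ) :
    (Matrix.of fun i j : Fin n => (Chebyshev.T ℝ (j : ℕ)).eval (v i)).det =
      (Matrix.vandermonde v).det * ∏ j : Fin n, 2 ^ ((j : ℕ) - 1) := by
  rw [Matrix.eval_matrixOfPolynomials_eq_vandermonde_mul_matrixOfPolynomials v
    (fun j => Chebyshev.T ℝ (j : ℕ)) (by simp), Matrix.det_mul,
    Matrix.det_of_isUpperTriangular (M := Matrix.of fun i j : Fin n =>
      (Chebyshev.T ℝ (j : ℕ)).coeff i)]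
  · congr 1
    refine Finset.prod_congr rfl fun j _ => ?_
    have := Chebyshev.leadingCoeff_T ℝ (j : ℕ)
    rwa [leadingCoeff, Chebyshev.natDegree_T, Int.natAbs_natCast] at this
  · intro i j hij
    refine coeff_eq_zero_of_natDegree_lt ?_
    rw [Chebyshev.natDegree_T, Int.natAbs_natCast]
    exact hij

lemma neg_one_pow_mul_det_vandermonde_pos {p : ℕ} {v : Fin (p + 1) → ℝ} (hv : StrictAnti v) :
    0 < (-1) ^ (p * (p + 1) / 2) * (Matrix.vandermonde v).det := by
  have hcard : p * (p + 1) / 2 = ∑ i : Fin (p + 1), (Ioi i).card := by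
    simp only [Fin.card_Ioi]
    rw [Fin.sum_univ_eq_sum_range (fun i => p + 1 - 1 - i) (p + 1),
      Finset.sum_range_reflect (fun i => i) (p + 1), Finset.sum_range_id, mul_comm,
      Nat.add_sub_cancel]
  rw [Matrix.det_vandermonde, hcard, ← Finset.prod_pow_eq_pow_sum, ← Finset.prod_mul_distrib]
  refine Finset.prod_pos fun i _ => ?_
  rw [← Finset.prod_const, ← Finset.prod_mul_distrib]
  refine Finset.prod_pos fun j hj => ?_
  linarith [hv (Finset.mem_Ioi.1 hj)]

lemma neg_one_pow_mul_det_cos_pos {N : ℕ} (hN : 0 < N) :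
    0 < (-1) ^ (N / 2 * (N / 2 + 1) / 2) * (Matrix.of fun i j : Fin (N / 2 + 1) =>
      Real.cos (2 * Real.pi * ((i : ℕ) * (j : ℕ) : ℕ) / N)).det := by
  have hN' : (0 : ℝ) < N := Nat.cast_pos.2 hN
  set v : Fin (N / 2 + 1) → ℝ := fun i => Real.cos (2 * Real.pi * (i : ℕ) / N) with hv
  have hanti : StrictAnti v := by
    intro i j hij
    refine Real.strictAntiOn_cos ⟨by positivity, ?_⟩ ⟨by positivity, ?_⟩ ?_
    · rw [div_le_iff₀ hN']
      have : ((2 * (i : ℕ) : ℕ) : ℝ) ≤ N := Nat.cast_le.2 (by omega)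
      push_cast at this
      nlinarith [Real.pi_pos]
    · rw [div_le_iff₀ hN']
      have : ((2 * (j : ℕ) : ℕ) : ℝ) ≤ N := Nat.cast_le.2 (by omega)
      push_cast at this
      nlinarith [Real.pi_pos]
    · have : ((i : ℕ) : ℝ) < (j : ℕ) := Nat.cast_lt.2 hij
      gcongr
  have hcos : (Matrix.of fun i j : Fin (N / 2 + 1) =>
      Real.cos (2 * Real.pi * ((i : ℕ) * (j : ℕ) : ℕ) / N)) =
      Matrix.of fun i j : Fin (N / 2 + 1) =>
        (Polynomial.Chebyshev.T ℝ (j : ℕ)).eval (v i) := by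
    ext i j
    simp only [Matrix.of_apply, hv, Polynomial.Chebyshev.T_real_cos]
    congr 1
    push_cast
    ring
  rw [hcos, det_eval_chebyshevT, ← mul_assoc]
  exact mul_pos (neg_one_pow_mul_det_vandermonde_pos hanti)
    (Finset.prod_pos fun _ _ => by positivity)

/-- The size of the orbit of `j` under `a ↦ -a` in `ℤ/Nℤ`. -/
def negOrbitCard (N j : ℕ) : ℕ := ({(j : ZMod N), -(j : ZMod N)} : Finset (ZMod N)).card

lemma negOrbitCard_pos (N j : ℕ) : 0 < negOrbitCard N j := by
  simp [negOrbitCard, Finset.card_pos]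

lemma ZMod.natCast_natAbs_valMinAbs_eq_or {N : ℕ} [NeZero N] (a : ZMod N) :
    (a.valMinAbs.natAbs : ZMod N) = a ∨ (a.valMinAbs.natAbs : ZMod N) = -a := by
  rw [ZMod.natCast_natAbs_valMinAbs]
  split_ifs <;> simp

lemma ZMod.natAbs_valMinAbs_eq_iff {N : ℕ} (a : ZMod N) {j : ℕ} (hj : j ≤ N / 2) :
    a.valMinAbs.natAbs = j ↔ a = j ∨ a = -j := by
  rw [← ZMod.natAbs_valMinAbs_eq_natAbs_valMinAbs, ZMod.valMinAbs_natCast_of_le_half hj,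
    Int.natAbs_natCast]

lemma sum_negOrbitCard_mul {N : ℕ} [NeZero N] (f : ZMod N → ℂ) (hf : ∀ a, f (-a) = f a) :
    ∑ j : Fin (N / 2 + 1), negOrbitCard N j * f ((j : ℕ) : ZMod N) = ∑ a, f a := by
  let φ : ZMod N → Fin (N / 2 + 1) := fun a =>
    ⟨a.valMinAbs.natAbs, Nat.lt_succ_of_le a.natAbs_valMinAbs_le⟩
  rw [← Finset.sum_fiberwise univ φ]
  refine Finset.sum_congr rfl fun j _ => ?_
  have hfib : (univ.filter fun a => φ a = j) = {((j : ℕ) : ZMod N), -((j : ℕ) : ZMod N)} := by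
    ext a
    simp only [Finset.mem_filter, Finset.mem_univ, true_and, Finset.mem_insert,
      Finset.mem_singleton, φ, Fin.ext_iff]
    exact ZMod.natAbs_valMinAbs_eq_iff a (Nat.le_of_lt_succ j.2)
  rw [hfib, Finset.sum_congr rfl (g := fun _ => f ((j : ℕ) : ZMod N)), Finset.sum_const,
    nsmul_eq_mul]
  · rfl
  · intro a ha
    rw [Finset.mem_insert, Finset.mem_singleton] at ha
    rcases ha with rfl | rfl
    · rfl
    · exact hf _

/-- The function `a ↦ cos (2πa/N)` on `ℤ/Nℤ`. -/
noncomputable def zmodCos {N : ℕ} [NeZero N] (a : ZMod N) : ℂ :=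
  (ZMod.stdAddChar a + ZMod.stdAddChar (-a)) / 2

lemma zmodCos_natCast {N : ℕ} [NeZero N] (m : ℕ) :
    zmodCos (m : ZMod N) = (Real.cos (2 * Real.pi * m / N) : ℝ) := by
  have h1 := ZMod.stdAddChar_coe (N := N) m
  have h2 := ZMod.stdAddChar_coe (N := N) (-m)
  push_cast at h1 h2
  rw [zmodCos, h1, h2, Complex.ofReal_cos, Complex.cos]
  push_cast
  congr 3 <;> ring_nf

lemma zmodCos_neg {N : ℕ} [NeZero N] (a : ZMod N) : zmodCos (-a) = zmodCos a := by
  rw [zmodCos, zmodCos, neg_neg, add_comm]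

lemma sum_mul_zmodCos {N : ℕ} [NeZero N] (f : ZMod N → ℂ) (hf : ∀ a, f (-a) = f a) (k : ZMod N) :
    ∑ a, f a * zmodCos (k * a) = ∑ a, f a * ZMod.stdAddChar (k * a) := by
  have h : ∑ a, f a * ZMod.stdAddChar (-(k * a)) = ∑ a, f a * ZMod.stdAddChar (k * a) := by
    rw [← Equiv.sum_comp (Equiv.neg (ZMod N))]
    simp [hf]
  simp only [zmodCos, mul_div_assoc', mul_add, ← Finset.sum_div, Finset.sum_add_distrib, h]
  ring

/-- The cosine matrix `cos (2πij/N)`, weighted so that it represents summation over `ℤ/Nℤ`. -/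
noncomputable def cosMat (N : ℕ) [NeZero N] : Matrix (Fin (N / 2 + 1)) (Fin (N / 2 + 1)) ℂ :=
  Matrix.of fun i j => negOrbitCard N i * zmodCos (((i : ℕ) : ZMod N) * ((j : ℕ) : ZMod N))

lemma cosMat_mul_self (N : ℕ) [NeZero N] : cosMat N * cosMat N = (N : ℂ) • 1 := by
  ext i k
  have hψ := ZMod.isPrimitive_stdAddChar N
  have hsum (b : ZMod N) : ∑ a : ZMod N, ZMod.stdAddChar (b * a) = if b = 0 then (N : ℂ) else 0 := by
    have := AddChar.sum_mulShift b hψ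
    simpa [mul_comm, ZMod.card] using this
  have h1 : (cosMat N * cosMat N) i k = negOrbitCard N i *
      ∑ a : ZMod N, zmodCos (((i : ℕ) : ZMod N) * a) * zmodCos (((k : ℕ) : ZMod N) * a) := by
    rw [Matrix.mul_apply, ← sum_negOrbitCard_mul, Finset.mul_sum]
    · refine Finset.sum_congr rfl fun j _ => ?_
      simp only [cosMat, Matrix.of_apply, mul_comm ((k : ℕ) : ZMod N)]
      ring
    · intro a
      simp only [mul_neg, zmodCos_neg]
  rw [h1, sum_mul_zmodCos _ (fun a => by rw [mul_neg, zmodCos_neg])]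
  have h2 : ∑ a : ZMod N, zmodCos (((i : ℕ) : ZMod N) * a) *
      ZMod.stdAddChar (((k : ℕ) : ZMod N) * a) =
      ((if ((i : ℕ) : ZMod N) = -((k : ℕ) : ZMod N) then (N : ℂ) else 0) +
        if ((i : ℕ) : ZMod N) = ((k : ℕ) : ZMod N) then (N : ℂ) else 0) / 2 := by
    have e1 := hsum ((i : ℕ) + (k : ℕ))
    have e2 := hsum (-(i : ℕ) + (k : ℕ))
    simp only [add_eq_zero_iff_eq_neg, neg_inj] at e1 e2
    rw [← e1, ← e2, ← Finset.sum_add_distrib, Finset.sum_div]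
    refine Finset.sum_congr rfl fun a _ => ?_
    rw [zmodCos, add_mul, add_mul, AddChar.map_add_eq_mul, AddChar.map_add_eq_mul, neg_mul]
    ring
  rw [h2]
  have hi := Nat.le_of_lt_succ i.2
  have hk := Nat.le_of_lt_succ k.2
  by_cases hik : i = k
  · subst hik
    simp only [if_true, Matrix.smul_apply, Matrix.one_apply_eq, negOrbitCard]
    split_ifs with h
    · rw [← h]
      simp
    · rw [Finset.card_pair h]
      push_cast
      ring
  · have hne := (ZMod.natAbs_valMinAbs_eq_iff ((i : ℕ) : ZMod N) hk).not
    rw [ZMod.valMinAbs_natCast_of_le_half hi, Int.natAbs_natCast, ← Fin.ext_iff] at hne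
    have := hne.1 hik
    push Not at this
    simp [this.1, this.2, Matrix.one_apply_ne hik]

lemma det_cosMat (N : ℕ) [NeZero N] :
    (cosMat N).det = (-1) ^ (N / 2 * (N / 2 + 1) / 2) * (Real.sqrt N : ℂ) ^ (N / 2 + 1) := by
  set e := N / 2 * (N / 2 + 1) / 2
  set C : Matrix (Fin (N / 2 + 1)) (Fin (N / 2 + 1)) ℝ := Matrix.of fun i j =>
    Real.cos (2 * Real.pi * ((i : ℕ) * (j : ℕ) : ℕ) / N)
  have hC : 0 < (-1) ^ e * C.det := neg_one_pow_mul_det_cos_pos (NeZero.pos N)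
  set x : ℝ := (∏ i : Fin (N / 2 + 1), (negOrbitCard N i : ℝ)) * C.det
  have hx : (cosMat N).det = x := by
    have : cosMat N = (Matrix.of fun i j : Fin (N / 2 + 1) =>
        (negOrbitCard N i : ℝ) * C i j).map Complex.ofRealHom := by
      ext i j
      simp only [cosMat, Matrix.of_apply, Matrix.map_apply, C]
      rw [← Nat.cast_mul, zmodCos_natCast]
      simp
    rw [this, ← RingHom.mapMatrix_apply, ← RingHom.map_det, Matrix.det_mul_column]
    rfl
  have hpos : 0 < (-1) ^ e * x := by
    have : 0 < ∏ i : Fin (N / 2 + 1), (negOrbitCard N i : ℝ) :=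
      Finset.prod_pos fun i _ => Nat.cast_pos.2 (negOrbitCard_pos N i)
    have := mul_pos this hC
    linarith
  have hsq : x ^ 2 = (N : ℝ) ^ (N / 2 + 1) := by
    have := congrArg Matrix.det (cosMat_mul_self N)
    rw [Matrix.det_mul, hx, Matrix.det_smul, Matrix.det_one, Fintype.card_fin, mul_one] at this
    rw [pow_two]
    exact_mod_cast this
  have hs : ((-1 : ℝ) ^ e) * (-1) ^ e = 1 := by rw [← mul_pow]; simp
  have hfin : (-1) ^ e * x = Real.sqrt N ^ (N / 2 + 1) := by
    refine (sq_eq_sq₀ hpos.le (by positivity)).1 ?_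
    rw [mul_pow, hsq, pow_right_comm √(N : ℝ), Real.sq_sqrt (Nat.cast_nonneg N), pow_two, hs,
      one_mul]
  have : x = (-1) ^ e * Real.sqrt N ^ (N / 2 + 1) := by
    rw [← hfin, ← mul_assoc, hs, one_mul]
  rw [hx, this]
  push_cast
  rfl

lemma ZMod.sum_eq_sum_range {n : ℕ} [NeZero n] (G : ZMod n → ℂ) :
    ∑ a, G a = ∑ x ∈ range n, G x :=
  Finset.sum_nbij' ZMod.val Nat.cast (by simp [ZMod.val_lt]) (by simp) (by simp)
    (fun x hx => ZMod.val_cast_of_lt (Finset.mem_range.1 hx)) (by simp)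

lemma ZMod.sum_range_mul {n : ℕ} [NeZero n] (d : ℕ) (G : ZMod n → ℂ) :
    ∑ x ∈ range (d * n), G x = d * ∑ a, G a := by
  induction d with
  | zero => simp
  | succ d ih =>
    rw [Nat.succ_mul, Finset.sum_range_add, ih, ZMod.sum_eq_sum_range G]
    push_cast
    simp only [ZMod.natCast_self, mul_zero, zero_add]
    ring

lemma stdAddChar_natCast_mul {N n d : ℕ} [NeZero N] [NeZero n] (h : d * n = N) (m : ℕ) :
    ZMod.stdAddChar ((d * m : ℕ) : ZMod N) = ZMod.stdAddChar (m : ZMod n) := by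
  have h1 := ZMod.stdAddChar_coe (N := N) (d * m : ℕ)
  have h2 := ZMod.stdAddChar_coe (N := n) m
  have hd : (d : ℂ) ≠ 0 := Nat.cast_ne_zero.2 fun h0 => NeZero.ne N (by simp [← h, h0])
  have hn : (n : ℂ) ≠ 0 := Nat.cast_ne_zero.2 (NeZero.ne n)
  rw [Int.cast_natCast] at h1 h2
  rw [h1, h2, ← h]
  push_cast
  congr 1
  field_simp

/-- The function `b ↦ y(db)` on `ℤ/nℤ`, where `N = dn`. -/
def mulPullback {N : ℕ} (y : ZMod N → ℂ) (d n : ℕ) (b : ZMod n) : ℂ := y ((d * b.val : ℕ) : ZMod N)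

lemma mulPullback_natCast {N n d : ℕ} (h : d * n = N) (y : ZMod N → ℂ) (m : ℕ) :
    mulPullback y d n m = y ((d * m : ℕ) : ZMod N) := by
  rw [mulPullback, ZMod.val_natCast]
  congr 1
  rw [ZMod.natCast_eq_natCast_iff, ← h]
  exact Nat.ModEq.mul_left' d (Nat.mod_modEq m n)

lemma mulPullback_neg {N n d : ℕ} [NeZero n] (h : d * n = N) {y : ZMod N → ℂ}
    (hy : ∀ a, y (-a) = y a) (b : ZMod n) : mulPullback y d n (-b) = mulPullback y d n b := by
  have hb : -b = ((n - b.val : ℕ) : ZMod n) := by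
    rw [Nat.cast_sub b.val_le]
    simp
  rw [hb, mulPullback_natCast h, mulPullback, ← hy]
  congr 1
  rw [neg_eq_iff_add_eq_zero, ← Nat.cast_add, ← mul_add, Nat.sub_add_cancel b.val_le, h,
    ZMod.natCast_self]

lemma two_mul_yhat {N d : ℕ} [NeZero (N / d)] (hd : d ∣ N) {y : ZMod N → ℂ}
    (hy : ∀ a, y (-a) = y a) (t : ZMod (N / d)) :
    2 * yhat N d y t = ∑ b, mulPullback y d (N / d) b * ZMod.stdAddChar (t * b) := by
  have h : d * (N / d) = N := Nat.mul_div_cancel' hd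
  rw [← sum_mul_zmodCos _ (mulPullback_neg h hy), ← Equiv.sum_comp (Equiv.addRight 1),
    ZMod.sum_eq_sum_range, yhat, ← mul_assoc, mul_one_div_cancel two_ne_zero, one_mul,
    ← Finset.Ico_add_one_right_eq_Icc, Finset.sum_Ico_eq_sum_range]
  refine Finset.sum_congr (by simp) fun r _ => ?_
  have e : (t * ((r : ZMod (N / d)) + 1)) = ((t.val * (1 + r) : ℕ) : ZMod (N / d)) := by
    simp [add_comm]
  have e' : (r : ZMod (N / d)) + 1 = ((1 + r : ℕ) : ZMod (N / d)) := by simp [add_comm]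
  simp only [Equiv.coe_addRight]
  rw [e, zmodCos_natCast, e', mulPullback_natCast h]
  push_cast
  ring_nf

lemma yhat_neg {N d : ℕ} [NeZero (N / d)] (hd : d ∣ N) {y : ZMod N → ℂ}
    (hy : ∀ a, y (-a) = y a) (t : ZMod (N / d)) : yhat N d y (-t) = yhat N d y t := by
  refine mul_left_cancel₀ (two_ne_zero (α := ℂ)) ?_
  rw [two_mul_yhat hd hy, two_mul_yhat hd hy, ← Equiv.sum_comp (Equiv.neg _)]
  simp [mulPullback_neg (Nat.mul_div_cancel' hd) hy]

lemma YMat_mul_cosMat_apply {N : ℕ} [NeZero N] {y : ZMod N → ℂ} (hy : ∀ a, y (-a) = y a)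
    (i k : Fin (N / 2 + 1)) :
    (YMat N y * cosMat N) i k =
      ∑ a : ZMod N, y (((i : ℕ) : ZMod N) * a) * ZMod.stdAddChar (((k : ℕ) : ZMod N) * a) := by
  have heven (a : ZMod N) : y (((i : ℕ) : ZMod N) * -a) = y (((i : ℕ) : ZMod N) * a) := by
    rw [mul_neg, hy]
  rw [← sum_mul_zmodCos _ heven, ← sum_negOrbitCard_mul, Matrix.mul_apply]
  · refine Finset.sum_congr rfl fun j _ => ?_
    simp only [YMat, cosMat, Matrix.of_apply, mul_comm ((k : ℕ) : ZMod N)]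
    ring
  · intro a
    rw [heven, mul_neg, zmodCos_neg]

lemma YMat_mul_cosMat_eq_zero {N : ℕ} [NeZero N] {y : ZMod N → ℂ} (hy : ∀ a, y (-a) = y a)
    {i k : Fin (N / 2 + 1)} (hik : ¬ Nat.gcd i N ∣ k) : (YMat N y * cosMat N) i k = 0 := by
  rw [YMat_mul_cosMat_apply hy]
  set S := ∑ a : ZMod N, y (((i : ℕ) : ZMod N) * a) * ZMod.stdAddChar (((k : ℕ) : ZMod N) * a) with hS
  set d := Nat.gcd i N
  have hd : d * (N / d) = N := Nat.mul_div_cancel' (Nat.gcd_dvd_right _ _)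
  have hi : ((i : ℕ) : ZMod N) * ((N / d : ℕ) : ZMod N) = 0 := by
    obtain ⟨u, hu⟩ : d ∣ i := Nat.gcd_dvd_left _ _
    rw [← Nat.cast_mul, ZMod.natCast_eq_zero_iff, hu]
    exact ⟨u, by rw [mul_right_comm, hd]⟩
  have hk : ((k : ℕ) : ZMod N) * ((N / d : ℕ) : ZMod N) ≠ 0 := by
    rw [← Nat.cast_mul, Ne, ZMod.natCast_eq_zero_iff]
    intro h
    apply hik
    nth_rewrite 1 [← hd] at h
    refine Nat.dvd_of_mul_dvd_mul_right (Nat.pos_of_ne_zero fun h0 => NeZero.ne N ?_) h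
    rw [← hd, h0, mul_zero]
  have hψ : ZMod.stdAddChar (((k : ℕ) : ZMod N) * ((N / d : ℕ) : ZMod N)) ≠ 1 := by
    rwa [← (ZMod.stdAddChar (N := N)).map_zero_eq_one, ZMod.injective_stdAddChar.ne_iff]
  have hshift : S = S * ZMod.stdAddChar (((k : ℕ) : ZMod N) * ((N / d : ℕ) : ZMod N)) := by
    nth_rewrite 1 [hS]
    rw [← Equiv.sum_comp (Equiv.addRight ((N / d : ℕ) : ZMod N)), hS, Finset.sum_mul]
    refine Finset.sum_congr rfl fun a _ => ?_
    rw [Equiv.coe_addRight, mul_add, mul_add, hi, add_zero, AddChar.map_add_eq_mul, mul_assoc]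
  by_contra hS0
  exact hψ (mul_left_cancel₀ hS0 (by rw [mul_one]; exact hshift.symm))

lemma sum_mul_stdAddChar_eq_yhat {N d : ℕ} [NeZero N] [NeZero (N / d)] (hd : d ∣ N)
    {y : ZMod N → ℂ} (hy : ∀ a, y (-a) = y a) (u v : ℕ) (U V : (ZMod (N / d))ˣ)
    (hU : (U : ZMod (N / d)) = u) (hV : (V : ZMod (N / d)) = v) :
    ∑ a : ZMod N, y (((d * u : ℕ) : ZMod N) * a) * ZMod.stdAddChar (((d * v : ℕ) : ZMod N) * a) =
      2 * (d * yhat N d y (U⁻¹ * V : (ZMod (N / d))ˣ)) := by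
  have h : d * (N / d) = N := Nat.mul_div_cancel' hd
  rw [mul_left_comm, two_mul_yhat hd hy, ZMod.sum_eq_sum_range]
  nth_rewrite 1 [← h]
  rw [← Equiv.sum_comp U.mulLeft, ← ZMod.sum_range_mul]
  refine Finset.sum_congr rfl fun x _ => ?_
  have e : ((U⁻¹ * V : (ZMod (N / d))ˣ) : ZMod (N / d)) * (U * (x : ZMod (N / d))) =
      ((v * x : ℕ) : ZMod (N / d)) := by
    rw [← mul_assoc, ← Units.val_mul, inv_mul_cancel_comm, hV, Nat.cast_mul]
  simp only [Units.mulLeft_apply]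
  rw [e, hU, ← Nat.cast_mul u, mulPullback_natCast h,
    ← stdAddChar_natCast_mul h, ← Nat.cast_mul, ← Nat.cast_mul, mul_assoc, mul_assoc]

lemma Units.mem_zpowers_neg_one {n : ℕ} [NeZero n] {g : (ZMod n)ˣ} :
    g ∈ Subgroup.zpowers (-1 : (ZMod n)ˣ) ↔ g = 1 ∨ g = -1 := by
  constructor
  · rw [← mem_powers_iff_mem_zpowers]
    rintro ⟨k, rfl⟩
    exact neg_one_pow_eq_or _ k
  · rintro (rfl | rfl)
    · exact one_mem _
    · exact Subgroup.mem_zpowers _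

lemma charProdEven_eq {n : ℕ} [NeZero n] [Fintype ((ZMod n)ˣ →* ℂˣ)]
    [DecidablePred fun ψ : (ZMod n)ˣ →* ℂˣ => Subgroup.zpowers (-1) ≤ ψ.ker]
    (c : ℂ) (g : ZMod n → ℂ) :
    charProdEven c n g = ∏ ψ : (ZMod n)ˣ →* ℂˣ with Subgroup.zpowers (-1) ≤ ψ.ker,
      (c * ∑ t : (ZMod n)ˣ, g t * (ψ t : ℂ)) := by
  obtain _ | n := n
  · exact absurd rfl (NeZero.ne 0)
  rw [charProdEven, Finset.prod_filter]
  refine Fintype.prod_equiv MulChar.equivToUnitHom _ _ fun χ => ?_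
  have h : χ (-1) = 1 ↔ Subgroup.zpowers (-1) ≤ (MulChar.equivToUnitHom χ).ker := by
    rw [Subgroup.zpowers_le, MonoidHom.mem_ker, Units.ext_iff, MulChar.coe_equivToUnitHom]
    simp
  simp only [h, MulChar.coe_equivToUnitHom]

/-- The factor `2` when `n ≤ 2`, where `-1 = 1` modulo `n`, and `1` otherwise. -/
def twoIfLeTwo (n : ℕ) : ℕ := if n ≤ 2 then 2 else 1

lemma card_zpowers_neg_one_mul {n : ℕ} [NeZero n] :
    twoIfLeTwo n * Nat.card (Subgroup.zpowers (-1 : (ZMod n)ˣ)) = 2 := by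
  rw [Nat.card_zpowers, twoIfLeTwo]
  split_ifs with h
  · have : (-1 : (ZMod n)ˣ) = 1 := by
      have := NeZero.pos n
      interval_cases n <;> decide
    simp [this]
  · have : Fact (2 < n) := ⟨not_le.1 h⟩
    have : Fact (Nat.Prime 2) := ⟨Nat.prime_two⟩
    rw [one_mul, orderOf_eq_prime (p := 2) neg_one_sq]
    intro h1
    exact ZMod.neg_one_ne_one (by simpa [Units.ext_iff] using h1)

lemma prod_twoIfLeTwo_mul {n : ℕ} [NeZero n] [Fintype ((ZMod n)ˣ →* ℂˣ)]
    [DecidablePred fun ψ : (ZMod n)ˣ →* ℂˣ => Subgroup.zpowers (-1) ≤ ψ.ker]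
    (φ : ((ZMod n)ˣ →* ℂˣ) → ℂ) :
    ∏ ψ : (ZMod n)ˣ →* ℂˣ with Subgroup.zpowers (-1) ≤ ψ.ker, twoIfLeTwo n * φ ψ =
      twoIfLeTwo n * ∏ ψ : (ZMod n)ˣ →* ℂˣ with Subgroup.zpowers (-1) ≤ ψ.ker, φ ψ := by
  by_cases h : n ≤ 2
  · have : Subsingleton (ZMod n)ˣ := by
      have := NeZero.pos n
      interval_cases n <;> exact ⟨by decide⟩
    have hone : (univ.filter fun ψ : (ZMod n)ˣ →* ℂˣ => Subgroup.zpowers (-1) ≤ ψ.ker) = {1} := by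
      ext ψ
      have : ψ = 1 := by
        ext t
        rw [Subsingleton.elim t 1, map_one, map_one]
      subst this
      simp
    rw [hone, Finset.prod_singleton, Finset.prod_singleton]
  · simp [twoIfLeTwo, h]

lemma prod_divisors_twoIfLeTwo {N : ℕ} (hN : 2 ≤ N) :
    ∏ d ∈ N.divisors, (twoIfLeTwo (N / d) : ℂ) = 2 ^ (N / 2 + 1 - (N - 1) / 2) := by
  rw [Nat.prod_div_divisors N fun d => (twoIfLeTwo d : ℂ)]
  simp only [twoIfLeTwo, Nat.cast_ite, Finset.prod_ite, Nat.cast_one, Finset.prod_const_one,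
    mul_one, Finset.prod_const, Nat.cast_ofNat]
  congr 1
  rcases Nat.even_or_odd' N with ⟨m, rfl | rfl⟩
  · have : ((2 * m).divisors.filter (· ≤ 2)) = {1, 2} := by
      ext d
      simp only [Finset.mem_filter, Nat.mem_divisors, Finset.mem_insert, Finset.mem_singleton]
      constructor
      · rintro ⟨⟨h1, h2⟩, h3⟩
        have := Nat.pos_of_dvd_of_pos h1 (by omega)
        omega
      · rintro (rfl | rfl)
        · exact ⟨⟨one_dvd _, by omega⟩, by omega⟩
        · exact ⟨⟨dvd_mul_right _ _, by omega⟩, le_rfl⟩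
    rw [this, Finset.card_pair (by norm_num)]
    omega
  · have : ((2 * m + 1).divisors.filter (· ≤ 2)) = {1} := by
      ext d
      simp only [Finset.mem_filter, Nat.mem_divisors, Finset.mem_singleton]
      constructor
      · rintro ⟨⟨h1, h2⟩, h3⟩
        have := Nat.pos_of_dvd_of_pos h1 (by omega)
        have : d ≠ 2 := by
          rintro rfl
          omega
        omega
      · rintro rfl
        exact ⟨⟨one_dvd _, by omega⟩, by omega⟩
    rw [this, Finset.card_singleton]
    omega

lemma image_gcd_eq_divisors {N : ℕ} (hN : N ≠ 0) :
    (univ.image fun i : Fin (N / 2 + 1) => Nat.gcd i N) = N.divisors := by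
  ext d
  simp only [Finset.mem_image, Finset.mem_univ, true_and, Nat.mem_divisors]
  constructor
  · rintro ⟨i, rfl⟩
    exact ⟨Nat.gcd_dvd_right _ _, hN⟩
  · rintro ⟨⟨n, rfl⟩, -⟩
    have hd : d ≠ 0 := left_ne_zero_of_mul hN
    have hn : n ≠ 0 := right_ne_zero_of_mul hN
    by_cases h1 : n = 1
    · subst h1
      exact ⟨0, by simp⟩
    · refine ⟨⟨d, Nat.lt_succ_of_le ?_⟩, Nat.gcd_eq_left (dvd_mul_right _ _)⟩
      rw [Nat.le_div_iff_mul_le two_pos]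
      exact Nat.mul_le_mul_left d (by omega)

section Block

variable {N d : ℕ}

lemma coprime_div_of_gcd_eq [NeZero N] {i : ℕ} (hi : Nat.gcd i N = d) :
    Nat.Coprime (i / d) (N / d) := by
  subst hi
  exact Nat.coprime_div_gcd_div_gcd (Nat.gcd_pos_of_pos_right _ (NeZero.pos N))

/-- The unit `i / d` modulo `N / d` attached to an index `i` with `gcd(i, N) = d`. -/
def blockUnit (N d : ℕ) [NeZero N] (i : {i : Fin (N / 2 + 1) // Nat.gcd i N = d}) :
    (ZMod (N / d))ˣ :=
  ZMod.unitOfCoprime ((i : Fin (N / 2 + 1)) / d) (coprime_div_of_gcd_eq i.2)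

lemma blockUnit_coe [NeZero N] (i : {i : Fin (N / 2 + 1) // Nat.gcd i N = d}) :
    (blockUnit N d i : ZMod (N / d)) = (((i : Fin (N / 2 + 1)) / d : ℕ) : ZMod (N / d)) :=
  ZMod.coe_unitOfCoprime _ _

lemma blockUnit_bijective [NeZero N] [NeZero (N / d)] (hd : d ∣ N) :
    Function.Bijective fun i : {i : Fin (N / 2 + 1) // Nat.gcd i N = d} =>
      (blockUnit N d i : (ZMod (N / d))ˣ ⧸ Subgroup.zpowers (-1 : (ZMod (N / d))ˣ)) := by
  have hdN : d * (N / d) = N := Nat.mul_div_cancel' hd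
  have hd0 : 0 < d := Nat.pos_of_dvd_of_pos hd (NeZero.pos N)
  constructor
  · intro i j hij
    have hle (i : {i : Fin (N / 2 + 1) // Nat.gcd i N = d}) :
        ((i : Fin (N / 2 + 1)) : ℕ) / d ≤ N / d / 2 := by
      rw [Nat.div_div_eq_div_mul, mul_comm d 2, ← Nat.div_div_eq_div_mul]
      exact Nat.div_le_div_right (Nat.le_of_lt_succ i.1.2)
    have hdvd (i : {i : Fin (N / 2 + 1) // Nat.gcd i N = d}) :
        d ∣ ((i : Fin (N / 2 + 1)) : ℕ) := by
      nth_rewrite 1 [← i.2]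
      exact Nat.gcd_dvd_left _ _
    have h := QuotientGroup.eq.1 hij
    rw [Units.mem_zpowers_neg_one, inv_mul_eq_one, inv_mul_eq_iff_eq_mul, mul_neg_one] at h
    have h' : (blockUnit N d i : ZMod (N / d)) = blockUnit N d j ∨
        (blockUnit N d i : ZMod (N / d)) = -blockUnit N d j := by
      rcases h with h | h
      · exact Or.inl (by rw [h])
      · exact Or.inr (by rw [h, Units.val_neg, neg_neg])
    rw [blockUnit_coe, blockUnit_coe, ← ZMod.natAbs_valMinAbs_eq_iff _ (hle j),
      ZMod.valMinAbs_natCast_of_le_half (hle i), Int.natAbs_natCast] at h'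
    exact Subtype.ext (Fin.ext ((Nat.div_left_inj (hdvd i) (hdvd j)).1 h'))
  · intro q
    obtain ⟨g, rfl⟩ := QuotientGroup.mk_surjective q
    set x := (g : ZMod (N / d)).valMinAbs.natAbs with hx
    have hxg := ZMod.natCast_natAbs_valMinAbs_eq_or (g : ZMod (N / d))
    rw [← hx] at hxg
    have hcop : Nat.Coprime x (N / d) := by
      rw [← ZMod.isUnit_iff_coprime]
      rcases hxg with h | h
      · rw [h]
        exact g.isUnit
      · rw [h]
        exact g.isUnit.neg
    have hle : d * x ≤ N / 2 := by
      have hx2 : x ≤ N / d / 2 := ZMod.natAbs_valMinAbs_le _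
      rw [Nat.le_div_iff_mul_le two_pos] at hx2 ⊢
      calc d * x * 2 = d * (x * 2) := mul_assoc _ _ _
        _ ≤ d * (N / d) := Nat.mul_le_mul_left d hx2
        _ = N := hdN
    have hgcd : Nat.gcd (d * x) N = d := by
      nth_rewrite 1 [← hdN]
      rw [Nat.gcd_mul_left, hcop.gcd_eq_one, mul_one]
    refine ⟨⟨⟨d * x, Nat.lt_succ_of_le hle⟩, hgcd⟩, ?_⟩
    rw [QuotientGroup.eq, Units.mem_zpowers_neg_one, inv_mul_eq_one, inv_mul_eq_iff_eq_mul,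
      mul_neg_one, Units.ext_iff, Units.ext_iff, Units.val_neg, blockUnit_coe,
      Nat.mul_div_cancel_left x hd0]
    rcases hxg with h | h
    · exact Or.inl h
    · exact Or.inr (by rw [h, neg_neg])

lemma det_toSquareBlock_YMat_mul_cosMat [NeZero N] (hd : d ∣ N) {y : ZMod N → ℂ}
    (hy : ∀ a, y (-a) = y a) :
    ((YMat N y * cosMat N).toSquareBlock (fun i => Nat.gcd i N) d).det =
      twoIfLeTwo (N / d) * charProdEven d (N / d) fun t => yhat N d y t := by
  classical
  have hd0 : 0 < d := Nat.pos_of_dvd_of_pos hd (NeZero.pos N)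
  have : NeZero (N / d) := ⟨(Nat.div_pos (Nat.le_of_dvd (NeZero.pos N) hd) hd0).ne'⟩
  have : Fintype ((ZMod (N / d))ˣ →* ℂˣ) := Fintype.ofFinite _
  set H := Subgroup.zpowers (-1 : (ZMod (N / d))ˣ) with hH
  let F : (ZMod (N / d))ˣ → ℂ := fun t => twoIfLeTwo (N / d) * (d * yhat N d y t)
  have hF (g) : ∀ h ∈ H, F (g * h) = F g := by
    intro h hh
    rcases Units.mem_zpowers_neg_one.1 hh with rfl | rfl
    · rw [mul_one]
    · simp only [F, mul_neg_one, Units.val_neg, yhat_neg hd hy]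
  have hmat : (YMat N y * cosMat N).toSquareBlock (fun i => Nat.gcd i N) d =
      Matrix.of fun a b => Nat.card H * F ((blockUnit N d a)⁻¹ * blockUnit N d b) := by
    ext a b
    have hdvd (i : {i : Fin (N / 2 + 1) // Nat.gcd i N = d}) :
        d * (((i : Fin (N / 2 + 1)) : ℕ) / d) = ((i : Fin (N / 2 + 1)) : ℕ) := by
      refine Nat.mul_div_cancel' ?_
      nth_rewrite 1 [← i.2]
      exact Nat.gcd_dvd_left _ _
    have h := sum_mul_stdAddChar_eq_yhat hd hy _ _ _ _ (blockUnit_coe a) (blockUnit_coe b)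
    rw [hdvd, hdvd] at h
    have h2 : (2 : ℂ) = Nat.card H * twoIfLeTwo (N / d) := by
      rw [mul_comm]
      exact_mod_cast (card_zpowers_neg_one_mul (n := N / d)).symm
    rw [Matrix.toSquareBlock_def, Matrix.of_apply, YMat_mul_cosMat_apply hy, h, h2,
      Matrix.of_apply, mul_assoc]
  rw [hmat, det_of_inv_mul_eq_prod_of_bijective H _ (blockUnit_bijective hd) F hF,
    charProdEven_eq, ← prod_twoIfLeTwo_mul]
  refine Finset.prod_congr rfl fun ψ _ => ?_
  simp only [F, Finset.mul_sum, mul_assoc]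

end Block

lemma det_YMat_mul_cosMat {N : ℕ} [NeZero N] {y : ZMod N → ℂ} (hy : ∀ a, y (-a) = y a) :
    (YMat N y * cosMat N).det = ∏ d ∈ N.divisors,
      (twoIfLeTwo (N / d) * charProdEven d (N / d) fun t => yhat N d y t) := by
  have htri : (YMat N y * cosMat N).BlockTriangular fun i => Nat.gcd i N := by
    intro i k hik
    refine YMat_mul_cosMat_eq_zero hy fun hdvd => ?_
    exact hik.not_ge (Nat.le_of_dvd (Nat.gcd_pos_of_pos_right _ (NeZero.pos N))
      (Nat.dvd_gcd hdvd (Nat.gcd_dvd_right _ _)))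
  rw [htri.det, image_gcd_eq_divisors (NeZero.ne N)]
  exact Finset.prod_congr rfl fun d hd =>
    det_toSquareBlock_YMat_mul_cosMat (Nat.dvd_of_mem_divisors hd) hy

/-- `det(Y_N) = (−1)^{N⁺(N⁺+1)/2} · 2^{N⁺+1−N⁻} · N^{−(N⁺+1)/2} ·
∏_{d ∣ N} ∏_{χ even mod N_d} (d · Σ_{t ∈ (ℤ/N_dℤ)ˣ} ŷ_d(t)·χ(t))`,
where `N⁺ = ⌊N/2⌋` and `N⁻ = ⌊(N−1)/2⌋`. -/
theorem det_YMat (N : ℕ) (hN : 2 ≤ N) (y : ZMod N → ℂ)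
    (hy : ∀ a : ZMod N, y (-a) = y a) :
    (YMat N y).det =
      (-1 : ℂ) ^ (N / 2 * (N / 2 + 1) / 2) * 2 ^ (N / 2 + 1 - (N - 1) / 2) *
        ((Real.sqrt N : ℂ)) ^ (-((N / 2 + 1 : ℕ) : ℤ)) *
        ∏ d ∈ N.divisors, charProdEven (d : ℂ) (N / d) (fun t => yhat N d y t) := by
  have : NeZero N := ⟨by omega⟩
  have hmul := det_YMat_mul_cosMat hy
  rw [Matrix.det_mul, det_cosMat, Finset.prod_mul_distrib, prod_divisors_twoIfLeTwo hN] at hmul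
  have hs : (Real.sqrt N : ℂ) ^ (N / 2 + 1) ≠ 0 := by
    refine pow_ne_zero _ (Complex.ofReal_ne_zero.2 (Real.sqrt_ne_zero'.2 ?_))
    exact Nat.cast_pos.2 (NeZero.pos N)
  have he : (-1 : ℂ) ^ (N / 2 * (N / 2 + 1) / 2) * (-1) ^ (N / 2 * (N / 2 + 1) / 2) = 1 := by
    rw [← mul_pow]
    simp
  rw [zpow_neg, zpow_natCast]
  calc (YMat N y).det = (-1) ^ (N / 2 * (N / 2 + 1) / 2) *
        ((YMat N y).det * ((-1) ^ (N / 2 * (N / 2 + 1) / 2) * (Real.sqrt N : ℂ) ^ (N / 2 + 1))) *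
        ((Real.sqrt N : ℂ) ^ (N / 2 + 1))⁻¹ := by
        rw [mul_left_comm, ← mul_assoc ((-1 : ℂ) ^ _), he, one_mul, mul_inv_cancel_right₀ hs]
    _ = _ := by
        rw [hmul]
        ring
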